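/- arXiv:2210.11116 — 3 statements merged into one kernel-verified Lean document; each statement's English description precedes it below -/
import Mathlib

section
/- Let n ≥ 5 and s be integers with 2 ≤ s ≤ ⌊(n−1)/2⌋, with n even, s even, and λ > γ > 0. Then diam(C_n(1,s)) = ⌈λ/2⌉ + (s−γ)/2 if γ ≤ 2⌈(s−2)/4⌉, and diam(C_n(1,s)) = ⌊λ/2⌋ + γ/2 otherwise. -/
open SimpleGraph

/-- Every walk in `C_n(1,s)` displaces its endpoint by `x + s y` for some integers with
`|x| + |y|` at most its length. -/
theorem exists_displacement_of_walk {n s : ℕ} {a b : ZMod n}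
    (w : (circulantGraph ({1, (s : ZMod n)} : Set (ZMod n))).Walk a b) :
    ∃ x y : ℤ, b = a + (x : ZMod n) + (s : ZMod n) * (y : ZMod n) ∧ |x| + |y| ≤ w.length := by
  induction w with
  | nil => exact ⟨0, 0, by simp, by simp⟩
  | @cons u v w h p ih =>
    obtain ⟨x, y, hb, hl⟩ := ih
    rw [Walk.length_cons]
    push_cast
    simp only [circulantGraph, fromRel_adj, Set.mem_insert_iff, Set.mem_singleton_iff] at h
    obtain ⟨-, (h | h) | (h | h)⟩ := h
    · refine ⟨x - 1, y, ?_, by have := abs_sub x 1; simp at this; linarith⟩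
      push_cast
      linear_combination hb - h
    · refine ⟨x, y - 1, ?_, by have := abs_sub y 1; simp at this; linarith⟩
      push_cast
      linear_combination hb - h
    · refine ⟨x + 1, y, ?_, by have := abs_add_le x 1; simp at this; linarith⟩
      push_cast
      linear_combination hb + h
    · refine ⟨x, y + 1, ?_, by have := abs_add_le y 1; simp at this; linarith⟩
      push_cast
      linear_combination hb + h

theorem edist_circulantGraph_add_nat_mul_le {G : Type*} [CommRing G] {S : Set G} {c : G}
    (hc : c ∈ S ∨ -c ∈ S) (a : G) (k : ℕ) :
    (circulantGraph S).edist a (a + k * c) ≤ k := by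
  induction k with
  | zero => simp
  | succ k ih =>
    refine (SimpleGraph.edist_triangle (v := a + k * c)).trans ?_
    push_cast
    refine add_le_add ih ?_
    by_cases h : a + k * c = a + (k + 1) * c
    · rw [h]
      simp
    · refine (edist_eq_one_iff_adj.2 ?_).le
      simp only [circulantGraph, fromRel_adj]
      refine ⟨h, ?_⟩
      rw [show a + k * c - (a + (k + 1) * c) = -c by ring,
        show a + (k + 1) * c - (a + k * c) = c by ring]
      exact hc.symm

theorem edist_circulantGraph_add_int_mul_le {G : Type*} [CommRing G] {S : Set G} {c : G}
    (hc : c ∈ S) (a : G) (k : ℤ) :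
    (circulantGraph S).edist a (a + k * c) ≤ k.natAbs := by
  obtain ⟨m, rfl | rfl⟩ := k.eq_nat_or_neg
  · simpa using edist_circulantGraph_add_nat_mul_le (Or.inl hc) a m
  · have := edist_circulantGraph_add_nat_mul_le (S := S) (c := -c) (by simp [hc]) a m
    simpa using this

theorem edist_circulantGraph_one_natCast_le {n s D : ℕ} (a b : ZMod n) (x y : ℤ)
    (hb : b = a + (x : ZMod n) + (s : ZMod n) * (y : ZMod n)) (hD : |x| + |y| ≤ D) :
    (circulantGraph ({1, (s : ZMod n)} : Set (ZMod n))).edist a b ≤ D := by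
  have h₁ := edist_circulantGraph_add_int_mul_le
    (S := ({1, (s : ZMod n)} : Set (ZMod n))) (c := 1) (by simp) a x
  have h₂ := edist_circulantGraph_add_int_mul_le
    (S := ({1, (s : ZMod n)} : Set (ZMod n))) (c := (s : ZMod n)) (by simp) (a + x * 1) y
  rw [show a + x * 1 + y * (s : ZMod n) = b by rw [hb]; ring] at h₂
  refine (SimpleGraph.edist_triangle (v := a + x * 1)).trans ((add_le_add h₁ h₂).trans ?_)
  have : x.natAbs + y.natAbs ≤ D := by
    rw [Int.abs_eq_natAbs, Int.abs_eq_natAbs] at hD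
    omega
  exact_mod_cast this

/-- With `n = λ s + γ`, every residue has a short representation `x + s y`. -/
theorem exists_short_representation {n s lam g h D : ℕ} (hs : s = 2 * (g + h))
    (hn : n = lam * s + 2 * g) (hs0 : 0 < s)
    (h₁ : (lam + 1) / 2 + h ≤ D) (h₂ : lam / 2 + g ≤ D) (v : ℕ) (hv : v < n) :
    ∃ x y : ℤ, ((v : ℤ) = x + s * y ∨ (v : ℤ) = x + s * y + n) ∧ |x| + |y| ≤ D := by
  obtain ⟨q, r, hr, hqr⟩ : ∃ q r : ℕ, r < s ∧ v = s * q + r :=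
    ⟨v / s, v % s, Nat.mod_lt _ hs0, (Nat.div_add_mod _ _).symm⟩
  have hq : q ≤ lam := by
    by_contra! hq
    have : (lam + 1) * s ≤ q * s := Nat.mul_le_mul_right _ hq
    nlinarith
  zify at hqr hn
  simp only [Int.abs_eq_natAbs]
  rcases lt_or_ge r (2 * g) with hrg | hrg
  · by_cases hc : r + q ≤ D
    · exact ⟨r, q, Or.inl (by linarith), by omega⟩
    · exact ⟨r - 2 * g, q - lam, Or.inr (by linear_combination hqr - hn), by omega⟩
  · have hq' : q ≠ lam := by
      rintro rfl
      nlinarith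
    by_cases hc : s - r + q + 1 ≤ D
    · exact ⟨r - s, q + 1, Or.inl (by linear_combination hqr), by omega⟩
    · exact ⟨r - 2 * g, q - lam, Or.inr (by linear_combination hqr - hn), by omega⟩

theorem le_representation_of_half_gamma {lam g h k : ℤ} (hg : 0 < g) (hh : 0 < h)
    (hlam : 2 * g < lam) (hk : 2 * k = lam ∨ 2 * k + 1 = lam) (t u : ℤ) :
    k + g ≤ |g + 2 * t * g - 2 * (g + h) * u| + |k + t * lam + u| := by
  set X := g + 2 * t * g - 2 * (g + h) * u with hX
  set Y := k + t * lam + u with hY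
  have hX₁ := le_abs_self X
  have hX₂ := neg_le_abs X
  have hY₁ := le_abs_self Y
  have hY₂ := neg_le_abs Y
  obtain ⟨hk₁, hk₂⟩ : 2 * k ≤ lam ∧ lam ≤ 2 * k + 1 := by omega
  rcases eq_or_ne u 0 with rfl | hu0
  · rcases le_or_gt 0 t with ht | ht
    · nlinarith [mul_nonneg ht hg.le, mul_nonneg ht (show 0 ≤ lam by linarith)]
    · have ht' : 0 ≤ -1 - t := by omega
      nlinarith [mul_nonneg ht' hg.le,
        mul_nonneg ht' (show 0 ≤ lam by linarith)]
  rcases le_or_gt 0 t with ht | ht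
  · rcases le_or_gt 1 u with hu | hu
    · nlinarith [mul_nonneg ht (sub_nonneg.2 hlam.le), mul_nonneg ht hg.le,
        mul_nonneg (sub_nonneg.2 hu) hg.le, mul_nonneg (sub_nonneg.2 hu) hh.le]
    · have hu' : 0 ≤ -1 - u := by omega
      nlinarith [mul_nonneg ht (sub_nonneg.2 hlam.le), mul_nonneg ht hg.le,
        mul_nonneg hu' hg.le, mul_nonneg hu' hh.le]
  · have ht' : 0 ≤ -1 - t := by omega
    rcases le_or_gt 1 u with hu | hu
    · nlinarith [mul_nonneg ht' (sub_nonneg.2 hlam.le), mul_nonneg ht' hg.le,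
        mul_nonneg (sub_nonneg.2 hu) hg.le, mul_nonneg (sub_nonneg.2 hu) hh.le]
    · have hu' : 0 ≤ -1 - u := by omega
      nlinarith [mul_nonneg ht' (sub_nonneg.2 hlam.le), mul_nonneg ht' hg.le,
        mul_nonneg hu' hg.le, mul_nonneg hu' hh.le]

theorem le_representation_of_half_sum {lam g h k : ℤ} (hg : 0 < g) (hh : 0 < h)
    (hlam : 2 * g < lam) (hk : 2 * k = lam ∨ 2 * k + 1 = lam) (t u : ℤ) :
    lam - k + h ≤ |2 * g + h + 2 * t * g - 2 * (g + h) * u| + |k + t * lam + u| := by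
  set X := 2 * g + h + 2 * t * g - 2 * (g + h) * u with hX
  set Y := k + t * lam + u with hY
  have hX₁ := le_abs_self X
  have hX₂ := neg_le_abs X
  have hY₁ := le_abs_self Y
  have hY₂ := neg_le_abs Y
  obtain ⟨hk₁, hk₂⟩ : 2 * k ≤ lam ∧ lam ≤ 2 * k + 1 := by omega
  rcases le_or_gt 0 t with ht | ht
  · rcases le_or_gt 1 u with hu | hu
    · nlinarith [mul_nonneg ht (sub_nonneg.2 hlam.le), mul_nonneg ht hg.le,
        mul_nonneg (sub_nonneg.2 hu) hg.le, mul_nonneg (sub_nonneg.2 hu) hh.le]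
    · have hu' : 0 ≤ -u := by omega
      nlinarith [mul_nonneg ht (sub_nonneg.2 hlam.le), mul_nonneg ht hg.le,
        mul_nonneg hu' hg.le, mul_nonneg hu' hh.le]
  · have ht' : 0 ≤ -1 - t := by omega
    rcases le_or_gt 1 u with hu | hu
    · nlinarith [mul_nonneg ht' (sub_nonneg.2 hlam.le), mul_nonneg ht' hg.le,
        mul_nonneg (sub_nonneg.2 hu) hg.le, mul_nonneg (sub_nonneg.2 hu) hh.le]
    · have hu' : 0 ≤ -u := by omega
      nlinarith [mul_nonneg ht' (sub_nonneg.2 hlam.le), mul_nonneg ht' hg.le,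
        mul_nonneg hu' hg.le, mul_nonneg hu' hh.le]

theorem le_ediam_of_representation {n s D : ℕ} (lam gam k r : ℤ)
    (hn : (n : ℤ) = lam * s + gam)
    (h : ∀ t u : ℤ, (D : ℤ) ≤ |r + t * gam - s * u| + |k + t * lam + u|) :
    (D : ℕ∞) ≤ (circulantGraph ({1, (s : ZMod n)} : Set (ZMod n))).ediam := by
  refine le_trans (le_iInf fun w => ?_)
    (edist_le_ediam (u := 0) (v := ((k * s + r : ℤ) : ZMod n)))
  obtain ⟨x, y, hb, hl⟩ := exists_displacement_of_walk w
  have hb' : ((k * s + r : ℤ) : ZMod n) = ((x + s * y : ℤ) : ZMod n) := by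
    rw [hb]
    push_cast
    ring
  obtain ⟨t, ht⟩ := (ZMod.intCast_eq_intCast_iff_dvd_sub _ _ _).1 hb'
  have := h t (y - k - t * lam)
  rw [show r + t * gam - s * (y - k - t * lam) = x by linear_combination -ht - t * hn,
    show k + t * lam + (y - k - t * lam) = y by ring] at this
  exact_mod_cast this.trans hl

/-- `n` even, `s` even, `λ > γ > 0`:
`diam(C_n(1,s)) = ⌈λ/2⌉ + (s-γ)/2` if `γ ≤ 2⌈(s-2)/4⌉`, and `⌊λ/2⌋ + γ/2` otherwise. -/
theorem diam_circulant_even_even (n s lam gam : ℕ) (hn : 5 ≤ n) (hs2 : 2 ≤ s)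
    (hs : s ≤ (n - 1) / 2) (hne : Even n) (hse : Even s)
    (hlam : lam = n / s) (hgam : gam = n % s) (hgam0 : 0 < gam) (hlg : gam < lam) :
    (circulantGraph ({1, (s : ZMod n)} : Set (ZMod n))).diam =
      if gam ≤ 2 * ((s - 2 + 3) / 4) then (lam + 1) / 2 + (s - gam) / 2
      else lam / 2 + gam / 2 := by
  have hlt : gam < s := hgam ▸ Nat.mod_lt _ (by omega)
  have hns : n = lam * s + gam := by rw [hlam, hgam, Nat.div_add_mod']
  have hge : Even gam := by
    rw [hgam]
    exact (Even.mod_even_iff hse).2 hne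
  obtain ⟨g, rfl⟩ := hge.two_dvd
  obtain ⟨m, rfl⟩ := hse.two_dvd
  obtain ⟨h, rfl⟩ : ∃ h, m = g + h := ⟨m - g, by omega⟩
  clear hlam hgam
  have : NeZero n := ⟨by omega⟩
  set D := max ((lam + 1) / 2 + h) (lam / 2 + g) with hD
  have hk : 2 * ((lam / 2 : ℕ) : ℤ) = lam ∨ 2 * ((lam / 2 : ℕ) : ℤ) + 1 = lam := by omega
  have hnz : (n : ℤ) = lam * (2 * (g + h) : ℕ) + (2 * g : ℕ) := by exact_mod_cast hns
  have key : (circulantGraph ({1, ((2 * (g + h) : ℕ) : ZMod n)} : Set (ZMod n))).ediam = D := by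
    apply le_antisymm
    · refine ediam_le_of_edist_le fun a b => ?_
      obtain ⟨x, y, hv, hxy⟩ := exists_short_representation (D := D) rfl hns (by omega)
        (le_max_left _ _) (le_max_right _ _) (b - a).val (ZMod.val_lt _)
      refine edist_circulantGraph_one_natCast_le a b x y ?_ hxy
      have hval : (((b - a).val : ℤ) : ZMod n) = b - a := by simp
      have hn0 : ((n : ℤ) : ZMod n) = 0 := by simp
      rcases hv with hv | hv <;> rw [hv] at hval
      · push_cast at hval ⊢
        linear_combination -hval
      · rw [Int.cast_add, hn0] at hval
        push_cast at hval ⊢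
        linear_combination -hval
    · rcases max_choice ((lam + 1) / 2 + h) (lam / 2 + g) with hmax | hmax
      · refine le_ediam_of_representation lam (2 * g : ℕ) (lam / 2 : ℕ) (2 * g + h) hnz
          fun t u => ?_
        refine le_trans ?_ ((le_representation_of_half_sum (g := g) (h := h) (by omega) (by omega)
          (by omega) hk t u).trans (le_of_eq ?_))
        · omega
        · push_cast
          ring_nf
      · refine le_ediam_of_representation lam (2 * g : ℕ) (lam / 2 : ℕ) g hnz fun t u => ?_
        refine le_trans ?_ ((le_representation_of_half_gamma (g := g) (h := h) (by omega)
          (by omega) (by omega) hk t u).trans (le_of_eq ?_))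
        · omega
        · push_cast
          ring_nf
  rw [diam, key, ENat.toNat_natCast]
  split_ifs <;> omega
end

section
/- Let n ≥ 5 and s be integers with 2 ≤ s ≤ ⌊(n−1)/2⌋, with n odd, s even, and λ > γ > 0. Then diam(C_n(1,s)) = ⌈λ/2⌉ + (s−2)/2 if γ = 1 or γ = s−1; diam(C_n(1,s)) = ⌊λ/2⌋ + (s−γ+1)/2 if 3 ≤ γ ≤ 2⌈s/4⌉ − 1; and diam(C_n(1,s)) = ⌈λ/2⌉ + (γ−1)/2 otherwise. -/
open SimpleGraph

section Circulant

variable {G : Type*} [AddCommGroup G]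

theorem edist_circulantGraph_add_zsmul_le {S : Set G} {g : G} (hg : g ∈ S) (u : G) (z : ℤ) :
    (circulantGraph S).edist u (u + z • g) ≤ z.natAbs := by
  have step (v : G) : (circulantGraph S).edist v (v + g) ≤ 1 := by
    rw [edist_le_one_iff_adj_or_eq, circulantGraph_adj]
    by_cases h : v = v + g
    · exact Or.inr h
    · exact Or.inl ⟨h, Or.inr (by simpa using hg)⟩
  have nat (k : ℕ) : ∀ v : G, (circulantGraph S).edist v (v + k • g) ≤ k := by
    induction k with
    | zero => simp
    | succ k ih =>
      intro v
      rw [succ_nsmul, ← add_assoc]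
      push_cast
      exact SimpleGraph.edist_triangle.trans (add_le_add (ih v) (step _))
  obtain h | h := z.natAbs_eq
  · nth_rw 1 [h]
    rw [natCast_zsmul]
    exact nat z.natAbs u
  · rw [SimpleGraph.edist_comm]
    have := nat z.natAbs (u + z • g)
    rwa [← natCast_zsmul, add_assoc, ← add_zsmul, show z + (z.natAbs : ℤ) = 0 by omega, zero_zsmul,
      add_zero] at this

theorem edist_circulantGraph_pair_le (g h u : G) (a b : ℤ) :
    (circulantGraph {g, h}).edist u (u + a • g + b • h) ≤ (a.natAbs + b.natAbs : ℕ) := by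
  push_cast
  exact SimpleGraph.edist_triangle.trans (add_le_add
    (edist_circulantGraph_add_zsmul_le (by simp) u a)
    (edist_circulantGraph_add_zsmul_le (by simp) _ b))

theorem exists_zsmul_of_walk_circulantGraph_pair {g h u v : G}
    (w : (circulantGraph {g, h}).Walk u v) :
    ∃ a b : ℤ, v = u + a • g + b • h ∧ a.natAbs + b.natAbs ≤ w.length := by
  induction w with
  | nil => exact ⟨0, 0, by simp⟩
  | @cons u v w hadj p ih =>
    obtain ⟨a, b, rfl, hab⟩ := ih
    rw [Walk.length_cons]
    rw [circulantGraph_adj] at hadj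
    obtain ⟨-, (h1 | h1) | (h1 | h1)⟩ := hadj
    · exact ⟨a - 1, b, by rw [sub_eq_iff_eq_add.1 h1]; module, by omega⟩
    · exact ⟨a, b - 1, by rw [sub_eq_iff_eq_add.1 h1]; module, by omega⟩
    · exact ⟨a + 1, b, by rw [sub_eq_iff_eq_add.1 h1]; module, by omega⟩
    · exact ⟨a, b + 1, by rw [sub_eq_iff_eq_add.1 h1]; module, by omega⟩

end Circulant

theorem diam_circulantGraph_zmod_pair {n s D : ℕ}
    (hupper : ∀ x : ℤ, ∃ a b i : ℤ, a + b * s = x - i * n ∧ (a.natAbs + b.natAbs : ℤ) ≤ D)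
    (hlower : ∃ x : ℤ, ∀ i a b : ℤ, a + b * s = x - i * n → (D : ℤ) ≤ a.natAbs + b.natAbs) :
    (circulantGraph ({1, (s : ZMod n)} : Set (ZMod n))).diam = D := by
  have hle : (circulantGraph ({1, (s : ZMod n)} : Set (ZMod n))).ediam ≤ D := by
    refine ediam_le_of_edist_le fun u v => ?_
    obtain ⟨x, hx⟩ := ZMod.intCast_surjective (v - u)
    obtain ⟨a, b, i, hab, hD⟩ := hupper x
    have hv : v = u + a • (1 : ZMod n) + b • (s : ZMod n) := by
      have := congrArg (Int.cast : ℤ → ZMod n) hab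
      push_cast at this
      rw [ZMod.natCast_self, mul_zero, sub_zero, hx] at this
      rw [zsmul_eq_mul, zsmul_eq_mul, mul_one, add_assoc, this]
      abel
    rw [hv]
    refine (edist_circulantGraph_pair_le _ _ u a b).trans ?_
    exact_mod_cast (by omega : a.natAbs + b.natAbs ≤ D)
  have htop : (circulantGraph ({1, (s : ZMod n)} : Set (ZMod n))).ediam ≠ ⊤ :=
    ne_top_of_le_ne_top (ENat.natCast_ne_top D) hle
  refine le_antisymm (ENat.toNat_le_of_le_natCast hle) ?_
  obtain ⟨x, hx⟩ := hlower
  refine le_trans ?_ (dist_le_diam htop (u := 0) (v := (x : ZMod n)))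
  obtain ⟨w, hw⟩ := (connected_of_ediam_ne_top htop).exists_walk_length_eq_dist 0 (x : ZMod n)
  obtain ⟨a, b, hab, hlen⟩ := exists_zsmul_of_walk_circulantGraph_pair w
  have hdvd : (n : ℤ) ∣ x - (a + b * s) := by
    rw [← ZMod.intCast_zmod_eq_zero_iff_dvd]
    push_cast
    rw [hab]
    simp
  obtain ⟨i, hi⟩ := hdvd
  have := hx i a b (by linarith)
  omega

/-- A lower bound, valid on a whole residue class, for the cost `|a| + |b|` of writing an integer
as `a + b * s`; it only involves the cheapest representations of `q * s + r` and of
`q * s + r - n`, where `n = (p + q) * s + g`. -/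
theorem le_abs_add_abs_of_add_mul_eq {s g p q r D n : ℤ} (hs : 2 ≤ s) (hg : 0 < g)
    (hgs : g < s) (hgl : g ≤ p + q) (hn : n = (p + q) * s + g) (hp : 1 ≤ p) (hq : 0 ≤ q)
    (hr : 0 ≤ r) (hrs : r ≤ s) (h₁ : D ≤ q + r) (h₂ : D ≤ q + 1 + s - r)
    (h₃ : D ≤ p + (r - g).natAbs) (h₄ : D ≤ p - 1 + s + g - r) (h₅ : D ≤ p + 1 + s + r - g)
    (i a b : ℤ) (hab : a + b * s = q * s + r - i * n) : D ≤ a.natAbs + b.natAbs := by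
  obtain hi | hi := le_or_gt 1 i
  · induction i, hi using Int.leInduction generalizing a b with
    | base =>
      obtain ⟨j, rfl⟩ : ∃ j, b = -(p + j) := ⟨-b - p, by ring⟩
      obtain rfl : a = r - g + j * s := by linear_combination hab - hn
      obtain hj | rfl | rfl | rfl | hj :
        j ≤ -2 ∨ j = -1 ∨ j = 0 ∨ j = 1 ∨ 2 ≤ j := by omega
      · have : 0 ≤ (-1 - j) * (s - 1) := mul_nonneg (by omega) (by omega)
        have : (-1 - j) * (s - 1) = -s + 1 - j * s + j := by ring
        omega
      · omega
      · omega
      · omega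
      · have : 0 ≤ (j - 1) * (s - 1) := mul_nonneg (by omega) (by omega)
        have : (j - 1) * (s - 1) = j * s - j - s + 1 := by ring
        omega
    | succ i hi ih =>
      have h := ih (a + g) (b + (p + q)) (by rw [hn] at hab ⊢; linear_combination hab)
      obtain hb | hb := le_or_gt (b + (p + q)) 0
      · omega
      · have e₁ : 0 ≤ (b + (p + q) - 1) * s := mul_nonneg (by omega) (by omega)
        have e₂ : 0 ≤ (p - 1) * (s - 1) := mul_nonneg (by omega) (by omega)
        have e₃ : 0 ≤ (i - 1) * n :=
          mul_nonneg (by omega) (by rw [hn]; nlinarith)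
        have : a ≤ r - g - g - p * s - s := by nlinarith
        have : p * s ≥ p + s - 1 := by linarith
        omega
  · have hi : i ≤ 0 := by omega
    induction i, hi using Int.leInductionDown generalizing a b with
    | base =>
      obtain ⟨j, rfl⟩ : ∃ j, b = q - j := ⟨q - b, by ring⟩
      obtain rfl : a = r + j * s := by linear_combination hab
      obtain hj | rfl | rfl | hj : j ≤ -2 ∨ j = -1 ∨ j = 0 ∨ 1 ≤ j := by omega
      · have : 0 ≤ (-1 - j) * (s - 1) := mul_nonneg (by omega) (by omega)
        have : (-1 - j) * (s - 1) = -s + 1 - j * s + j := by ring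
        omega
      · omega
      · omega
      · have : 0 ≤ j * (s - 1) := mul_nonneg (by omega) (by omega)
        have : j * (s - 1) = j * s - j := by ring
        omega
    | pred i hi ih =>
      have h := ih (a - g) (b - (p + q)) (by rw [hn] at hab ⊢; linear_combination hab) (by omega)
      obtain hb | hb := le_or_gt 0 (b - (p + q))
      · omega
      · have e₁ : 0 ≤ (p + q - 1 - b) * s := mul_nonneg (by omega) (by omega)
        have e₂ : 0 ≤ q * (s - 1) := mul_nonneg (by omega) (by omega)
        have e₃ : 0 ≤ -i * n :=
          mul_nonneg (by omega) (by rw [hn]; nlinarith)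
        have : r + g + q * s + s ≤ a := by nlinarith
        have : q * s ≥ q := by linarith
        omega

/-- An integer `x` has four cheap representations `a + b * s` modulo `n = l * s + g`; if every
`r` in `[0, s)` satisfies the balance condition `hD`, one of them costs at most `D`. -/
theorem exists_add_mul_eq_abs_add_abs_le {s g l D n : ℤ} (hs : 0 < s) (hg : 0 < g) (hgs : g < s)
    (hl : 0 ≤ l) (hn : n = l * s + g)
    (hD : ∀ r, 0 ≤ r → r < s →
      l + min r (s + 1 - r) + min ((r - g).natAbs : ℤ) (s + g - 1 - r) ≤ 2 * D + 1) (x : ℤ) :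
    ∃ a b i : ℤ, a + b * s = x - i * n ∧ (a.natAbs + b.natAbs : ℤ) ≤ D := by
  have hn0 : 0 < n := by rw [hn]; positivity
  obtain ⟨y, k, rfl, hy0, hyn⟩ : ∃ y k, x = y + k * n ∧ 0 ≤ y ∧ y < n :=
    ⟨x % n, x / n, by linarith [Int.emod_add_mul_ediv x n, mul_comm n (x / n)],
      Int.emod_nonneg _ hn0.ne', Int.emod_lt_of_pos _ hn0⟩
  obtain ⟨q, r, rfl, hr0, hrs⟩ : ∃ q r, y = q * s + r ∧ 0 ≤ r ∧ r < s :=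
    ⟨y / s, y % s, by linarith [Int.emod_add_mul_ediv y s, mul_comm s (y / s)],
      Int.emod_nonneg _ hs.ne', Int.emod_lt_of_pos _ hs⟩
  have hq0 : 0 ≤ q := by
    by_contra! h
    nlinarith
  have hql : q ≤ l := by
    by_contra! h
    nlinarith
  have hqr : q = l → r < g := by
    rintro rfl
    linarith
  specialize hD r hr0 hrs
  obtain h | h | h | h : q + r ≤ D ∨ q + 1 + s - r ≤ D ∨ l - q + (r - g).natAbs ≤ D ∨
      (r - g - s).natAbs + (q + 1 - l).natAbs ≤ D := by
    omega
  · exact ⟨r, q, k, by ring, by omega⟩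
  · exact ⟨r - s, q + 1, k, by ring, by omega⟩
  · exact ⟨r - g, q - l, k + 1, by rw [hn]; ring, by omega⟩
  · exact ⟨r - g - s, q + 1 - l, k + 1, by rw [hn]; ring, h⟩

/-- `n` odd, `s` even, `λ > γ > 0`:
`diam(C_n(1,s)) = ⌈λ/2⌉ + (s-2)/2` if `γ = 1` or `γ = s-1`;
`= ⌊λ/2⌋ + (s-γ+1)/2` if `3 ≤ γ ≤ 2⌈s/4⌉ - 1`; and `= ⌈λ/2⌉ + (γ-1)/2` otherwise. -/
theorem diam_circulant_odd_even (n s lam gam : ℕ) (hn : 5 ≤ n) (hs2 : 2 ≤ s)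
    (hs : s ≤ (n - 1) / 2) (hno : Odd n) (hse : Even s)
    (hlam : lam = n / s) (hgam : gam = n % s) (hgam0 : 0 < gam) (hlg : gam < lam) :
    (circulantGraph ({1, (s : ZMod n)} : Set (ZMod n))).diam =
      if gam = 1 ∨ gam = s - 1 then (lam + 1) / 2 + (s - 2) / 2
      else if 3 ≤ gam ∧ gam ≤ 2 * ((s + 3) / 4) - 1 then lam / 2 + (s - gam + 1) / 2
      else (lam + 1) / 2 + (gam - 1) / 2 := by
  obtain ⟨m, rfl⟩ := hse
  have hnlg : n = lam * (m + m) + gam := by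
    rw [hlam, hgam, mul_comm, Nat.div_add_mod]
  have hgs : gam < m + m := hgam ▸ Nat.mod_lt _ (by omega)
  have hgo : gam % 2 = 1 := by
    have h := Nat.odd_iff.1 hno
    rw [hnlg, ← mul_two, ← mul_assoc] at h
    omega
  have hnz : (n : ℤ) = lam * ((m + m : ℕ) : ℤ) + gam := by exact_mod_cast hnlg
  set D : ℕ := if gam = 1 ∨ gam = m + m - 1 then (lam + 1) / 2 + (m + m - 2) / 2
    else if 3 ≤ gam ∧ gam ≤ 2 * ((m + m + 3) / 4) - 1 then lam / 2 + (m + m - gam + 1) / 2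
    else (lam + 1) / 2 + (gam - 1) / 2 with hD
  refine diam_circulantGraph_zmod_pair
    (exists_add_mul_eq_abs_add_abs_le (g := gam) (l := lam) (by omega) (by omega) (by omega)
      (by omega) hnz fun r hr0 hrs => by split_ifs at hD <;> omega) ?_
  obtain ⟨p, q, r, hpq, hp, hq, hr, hrs, h₁, h₂, h₃, h₄, h₅⟩ : ∃ p q r : ℤ, p + q = lam ∧ 1 ≤ p ∧
      0 ≤ q ∧ 0 ≤ r ∧ r ≤ (m + m : ℕ) ∧ (D : ℤ) ≤ q + r ∧ D ≤ q + 1 + (m + m : ℕ) - r ∧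
      D ≤ p + (r - gam).natAbs ∧ D ≤ p - 1 + (m + m : ℕ) + gam - r ∧
      D ≤ p + 1 + (m + m : ℕ) + r - gam := by
    split_ifs at hD
    · exact ⟨lam - ((lam + 1) / 2 - 1), (lam + 1) / 2 - 1, m, by omega⟩
    · exact ⟨lam - lam / 2, lam / 2, (m + m + 1 + gam) / 2, by omega⟩
    · exact ⟨lam - (lam + 1) / 2, (lam + 1) / 2, (gam - 1) / 2, by omega⟩
  exact ⟨q * (m + m : ℕ) + r, le_abs_add_abs_of_add_mul_eq (g := gam) (by omega) (by omega)
    (by omega) (by omega) (hpq ▸ hnz) hp hq hr hrs h₁ h₂ h₃ h₄ h₅⟩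
end

section
/- Let n ≥ 5 and s be integers with 2 ≤ s ≤ ⌊(n−1)/2⌋, with n odd, s even, and λ > γ > 0. Then diam(C_n(1,s)) ≤ ⌈λ/2⌉ + (s−2)/2 if γ = 1 or γ = s−1; diam(C_n(1,s)) ≤ ⌊λ/2⌋ + (s−γ+1)/2 if 3 ≤ γ ≤ 2⌈s/4⌉ − 1; and diam(C_n(1,s)) ≤ ⌈λ/2⌉ + (γ−1)/2 otherwise. -/
open SimpleGraph

theorem circulantGraph_edist_add_le_one {G : Type*} [AddCommGroup G] {S : Set G} {a : G}
    (ha : a ∈ S) (u : G) : (circulantGraph S).edist u (u + a) ≤ 1 := by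
  by_cases h : u = u + a
  · rw [← h]; simp
  · refine edist_le_one_iff_adj_or_eq.2 (Or.inl ?_)
    simp only [circulantGraph, SimpleGraph.fromRel_adj]
    exact ⟨h, Or.inr (by simpa using ha)⟩

theorem circulantGraph_edist_add_nsmul_le {G : Type*} [AddCommGroup G] {S : Set G} {a : G}
    (ha : a ∈ S) (u : G) (k : ℕ) : (circulantGraph S).edist u (u + k • a) ≤ k := by
  induction k with
  | zero => simp
  | succ k ih =>
    rw [succ_nsmul, ← add_assoc]
    refine (SimpleGraph.edist_triangle (v := u + k • a)).trans ?_
    push_cast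
    exact add_le_add ih (circulantGraph_edist_add_le_one ha _)

theorem circulantGraph_edist_add_zsmul_le {G : Type*} [AddCommGroup G] {S : Set G} {a : G}
    (ha : a ∈ S) (u : G) (k : ℤ) : (circulantGraph S).edist u (u + k • a) ≤ k.natAbs := by
  obtain h | h := k.natAbs_eq
  · have := circulantGraph_edist_add_nsmul_le ha u k.natAbs
    rwa [← natCast_zsmul, ← h] at this
  · have := circulantGraph_edist_add_nsmul_le ha (u + k • a) k.natAbs
    rw [← natCast_zsmul, SimpleGraph.edist_comm, add_assoc, ← add_zsmul] at this
    rwa [show k + (k.natAbs : ℤ) = 0 by omega, zero_zsmul, add_zero] at this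

theorem circulantGraph_edist_add_zsmul_add_zsmul_le {G : Type*} [AddCommGroup G] {S : Set G}
    {a b : G} (ha : a ∈ S) (hb : b ∈ S) (u : G) (x y : ℤ) :
    (circulantGraph S).edist u (u + x • a + y • b) ≤ (x.natAbs + y.natAbs : ℕ) := by
  refine (SimpleGraph.edist_triangle (v := u + x • a)).trans ?_
  push_cast
  exact add_le_add (circulantGraph_edist_add_zsmul_le ha _ _)
    (circulantGraph_edist_add_zsmul_le hb _ _)

/-- Every residue `q * s + r` has a representation `x + y * s` modulo `n = lam * s + gam` of small
`ℓ¹` norm, with `(x, y)` obtained from `(r, q)` by adding multiples `i` and `j` of the relations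
`(s, -1)` and `(gam, lam)`. -/
theorem exists_short_representation_s11 (s lam gam q r : ℕ) (hse : Even s) (hgo : Odd gam)
    (hgs : gam < s) (hlg : gam < lam) (hr : r < s) (hq : q ≤ lam) (hqr : q = lam → r < gam) :
    ∃ i j : ℤ, ((r + i * s + j * gam).natAbs + (q - i + j * lam).natAbs : ℕ) ≤
      if gam = 1 ∨ gam = s - 1 then (lam + 1) / 2 + (s - 2) / 2
      else if 3 ≤ gam ∧ gam ≤ 2 * ((s + 3) / 4) - 1 then lam / 2 + (s - gam + 1) / 2
      else (lam + 1) / 2 + (gam - 1) / 2 := by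
  obtain ⟨t, rfl⟩ := hse
  obtain ⟨g, rfl⟩ := hgo
  by_contra! h
  have hA := h 0 0
  have hB := h (-1) 0
  have hC := h 0 (-1)
  have hD := h (-1) (-1)
  have hE := h 1 (-1)
  clear h
  push_cast at hA hB hC hD hE
  split_ifs at hA hB hC hD hE <;> omega

/-- `n` odd, `s` even, `λ > γ > 0`:
`diam(C_n(1,s)) ≤ ⌈λ/2⌉ + (s-2)/2` if `γ = 1` or `γ = s-1`;
`≤ ⌊λ/2⌋ + (s-γ+1)/2` if `3 ≤ γ ≤ 2⌈s/4⌉ - 1`; and `≤ ⌈λ/2⌉ + (γ-1)/2` otherwise. -/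
theorem diam_circulant_odd_even_le (n s lam gam : ℕ) (hn : 5 ≤ n) (hs2 : 2 ≤ s)
    (hs : s ≤ (n - 1) / 2) (hno : Odd n) (hse : Even s)
    (hlam : lam = n / s) (hgam : gam = n % s) (hgam0 : 0 < gam) (hlg : gam < lam) :
    (circulantGraph ({1, (s : ZMod n)} : Set (ZMod n))).diam ≤
      if gam = 1 ∨ gam = s - 1 then (lam + 1) / 2 + (s - 2) / 2
      else if 3 ≤ gam ∧ gam ≤ 2 * ((s + 3) / 4) - 1 then lam / 2 + (s - gam + 1) / 2
      else (lam + 1) / 2 + (gam - 1) / 2 := by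
  have hne : NeZero n := ⟨by omega⟩
  have hns : s * lam + gam = n := by rw [hlam, hgam]; exact Nat.div_add_mod n s
  have hgs : gam < s := hgam ▸ Nat.mod_lt _ (by omega)
  have hgo : Odd gam := (Nat.odd_add'.1 (hns ▸ hno)).2 (hse.mul_right lam)
  refine ENat.toNat_le_of_le_natCast (SimpleGraph.ediam_le_iff.2 fun u v ↦ ?_)
  obtain ⟨q, r, hr, hq, hqr, huv⟩ : ∃ q r : ℕ, r < s ∧ q ≤ lam ∧ (q = lam → r < gam) ∧
      (s : ZMod n) * q + r = v - u := by
    have hw : (v - u).val < n := ZMod.val_lt _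
    have hdiv := Nat.div_add_mod (v - u).val s
    refine ⟨(v - u).val / s, (v - u).val % s, Nat.mod_lt _ (by omega),
      hlam ▸ Nat.div_le_div_right hw.le, fun h ↦ ?_, ?_⟩
    · rw [h] at hdiv
      omega
    · simpa using congrArg (Nat.cast : ℕ → ZMod n) hdiv
  obtain ⟨i, j, hij⟩ := exists_short_representation_s11 s lam gam q r hse hgo hgs hlg hr hq hqr
  have hrel : (s : ZMod n) * lam + gam = 0 := by
    simpa using congrArg (Nat.cast : ℕ → ZMod n) hns
  have hv : v = u + (r + i * s + j * gam : ℤ) • (1 : ZMod n)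
      + (q - i + j * lam : ℤ) • (s : ZMod n) := by
    simp only [zsmul_eq_mul]
    push_cast
    linear_combination -huv - j * hrel
  have key := circulantGraph_edist_add_zsmul_add_zsmul_le (S := {1, (s : ZMod n)})
    (a := 1) (b := s) (by simp) (by simp) u (r + i * s + j * gam) (q - i + j * lam)
  rw [← hv] at key
  exact key.trans (by exact_mod_cast hij)
end
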